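/- For every a ≥ 0 there is a unique q_a ∈ [0, σ_max(F)^{−2}) with 𝒜(q_a) = a, and the a-anisotropic norm of F is given by ⦀F⦀_a = 𝒩(q_a). -/

import Mathlib

open MeasureTheory Real Matrix

/-- The largest singular value of `F`: the supremum of `‖F w‖` over unit vectors. -/
noncomputable def sigmaMax {s ℓ : ℕ} (F : Matrix (Fin s) (Fin ℓ) ℝ) : ℝ :=
  sSup {x : ℝ | ∃ w : Fin ℓ → ℝ, (∑ i, (w i)^2) = 1 ∧ x = Real.sqrt (∑ j, (F.mulVec w j)^2)}

/-- `S(q) = (I − qΛ)⁻¹` with `Λ = FᵀF`. -/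
noncomputable def Sq {s ℓ : ℕ} (F : Matrix (Fin s) (Fin ℓ) ℝ) (q : ℝ) :
    Matrix (Fin ℓ) (Fin ℓ) ℝ :=
  (1 - q • (Fᵀ * F))⁻¹

/-- `𝒜(q) = −(1/2)·ln det(ℓ·S(q)/Tr S(q))`. -/
noncomputable def Afun {s ℓ : ℕ} (F : Matrix (Fin s) (Fin ℓ) ℝ) (q : ℝ) : ℝ :=
  -(1 / 2) * Real.log ((((ℓ : ℝ) / (Sq F q).trace) • Sq F q).det)

/-- `𝒩(q) = sqrt(Tr(Λ·S(q))/Tr S(q))`. -/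
noncomputable def Nfun {s ℓ : ℕ} (F : Matrix (Fin s) (Fin ℓ) ℝ) (q : ℝ) : ℝ :=
  Real.sqrt ((Fᵀ * F * Sq F q).trace / (Sq F q).trace)

/-- `𝔄(q,γ) = (1/2)·ln det(I − qΛ) − (ℓ/2)·ln(1 − qγ²)`. -/
noncomputable def AAfun {s ℓ : ℕ} (F : Matrix (Fin s) (Fin ℓ) ℝ) (q γ : ℝ) : ℝ :=
  (1 / 2) * Real.log (1 - q • (Fᵀ * F)).det - ((ℓ : ℝ) / 2) * Real.log (1 - q * γ^2)
/-- Second moment `E_f = ∫ |w|² f(w) dw` of a density on `ℝ^ℓ`. -/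
noncomputable def Ef (ℓ : ℕ) (f : (Fin ℓ → ℝ) → ℝ) : ℝ :=
  ∫ w : Fin ℓ → ℝ, (∑ i, (w i)^2) * f w

/-- Differential entropy `h(f) = −∫ f ln f`. -/
noncomputable def dEnt (ℓ : ℕ) (f : (Fin ℓ → ℝ) → ℝ) : ℝ :=
  -∫ w : Fin ℓ → ℝ, f w * Real.log (f w)

/-- Anisotropy `A(f) = (ℓ/2)·ln(2πe·E_f/ℓ) − h(f)`. -/
noncomputable def aniso (ℓ : ℕ) (f : (Fin ℓ → ℝ) → ℝ) : ℝ :=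
  ((ℓ : ℝ) / 2) * Real.log (2 * π * Real.exp 1 * Ef ℓ f / ℓ) - dEnt ℓ f

/-- A probability density on `ℝ^ℓ` with finite positive second moment and
finite differential entropy. -/
structure IsGoodDensity (ℓ : ℕ) (f : (Fin ℓ → ℝ) → ℝ) : Prop where
  nonneg : ∀ w, 0 ≤ f w
  integrable : Integrable f
  total : (∫ w, f w) = 1
  moment_integrable : Integrable (fun w : Fin ℓ → ℝ => (∑ i, (w i)^2) * f w)
  moment_pos : 0 < Ef ℓ f
  entropy_integrable : Integrable (fun w : Fin ℓ → ℝ => f w * Real.log (f w))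

/-- The RMS gain `R(F,f) = sqrt((∫ |F w|² f(w) dw)/E_f)`. -/
noncomputable def RMS {s ℓ : ℕ} (F : Matrix (Fin s) (Fin ℓ) ℝ) (f : (Fin ℓ → ℝ) → ℝ) : ℝ :=
  Real.sqrt ((∫ w : Fin ℓ → ℝ, (∑ j, (F.mulVec w j)^2) * f w) / Ef ℓ f)

/-- Frobenius norm of a matrix. -/
noncomputable def frobNorm {s ℓ : ℕ} (F : Matrix (Fin s) (Fin ℓ) ℝ) : ℝ :=
  Real.sqrt ((Fᵀ * F).trace)

/-- The `a`-anisotropic norm `⦀F⦀_a = sup{R(F,f) : A(f) ≤ a}`. -/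
noncomputable def anorm {s ℓ : ℕ} (a : ℝ) (F : Matrix (Fin s) (Fin ℓ) ℝ) : ℝ :=
  sSup {x : ℝ | ∃ f : (Fin ℓ → ℝ) → ℝ, IsGoodDensity ℓ f ∧ aniso ℓ f ≤ a ∧ x = RMS F f}


theorem diagz {s ℓ : ℕ} (F : Matrix (Fin s) (Fin ℓ) ℝ) :
    ∃ (V : Matrix (Fin ℓ) (Fin ℓ) ℝ) (lam : Fin ℓ → ℝ), V * Vᵀ = 1 ∧ Vᵀ * V = 1 ∧
      Fᵀ * F = Vᵀ * diagonal lam * V := by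
  have hH : (Fᵀ * F).IsHermitian := by
    simpa using Matrix.isHermitian_conjTranspose_mul_self F
  have h := hH.spectral_theorem
  rw [Unitary.conjStarAlgAut_apply] at h
  refine ⟨star (hH.eigenvectorUnitary : Matrix (Fin ℓ) (Fin ℓ) ℝ), hH.eigenvalues, ?_, ?_, ?_⟩
  · have := Unitary.coe_star_mul_self hH.eigenvectorUnitary
    simpa [Matrix.star_eq_conjTranspose] using this
  · have := Unitary.coe_mul_star_self hH.eigenvectorUnitary
    simpa [Matrix.star_eq_conjTranspose] using this
  · refine h.trans ?_
    simp [Matrix.star_eq_conjTranspose]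

theorem sumsq_V {ℓ : ℕ} (V : Matrix (Fin ℓ) (Fin ℓ) ℝ) (h : Vᵀ * V = 1) (w : Fin ℓ → ℝ) :
    ∑ i, (V.mulVec w i)^2 = ∑ i, (w i)^2 := by
  have : ∀ u : Fin ℓ → ℝ, ∑ i, (u i)^2 = u ⬝ᵥ u := fun u => by
    simp [dotProduct, sq]
  rw [this, this, Matrix.dotProduct_mulVec, Matrix.vecMul_mulVec, h, Matrix.vecMul_one]

theorem sumsq_F {s ℓ : ℕ} (F : Matrix (Fin s) (Fin ℓ) ℝ) (V : Matrix (Fin ℓ) (Fin ℓ) ℝ)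
    (lam : Fin ℓ → ℝ) (hF : Fᵀ * F = Vᵀ * diagonal lam * V) (w : Fin ℓ → ℝ) :
    ∑ j, (F.mulVec w j)^2 = ∑ i, lam i * (V.mulVec w i)^2 := by
  have : ∑ j, (F.mulVec w j)^2 = F.mulVec w ⬝ᵥ F.mulVec w := by
    simp [dotProduct, sq]
  rw [this, Matrix.dotProduct_mulVec, Matrix.vecMul_mulVec, hF, ← Matrix.dotProduct_mulVec,
    ← Matrix.mulVec_mulVec, ← Matrix.mulVec_mulVec, Matrix.dotProduct_mulVec, Matrix.vecMul_transpose]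
  simp [dotProduct, Matrix.mulVec_diagonal]
  exact Finset.sum_congr rfl fun i _ => by ring

theorem sigma_spec {s ℓ : ℕ} (F : Matrix (Fin s) (Fin ℓ) ℝ) (V : Matrix (Fin ℓ) (Fin ℓ) ℝ)
    (lam : Fin ℓ → ℝ) (hV : V * Vᵀ = 1) (hV' : Vᵀ * V = 1)
    (hF : Fᵀ * F = Vᵀ * diagonal lam * V) (hℓ : 0 < ℓ) :
    (∀ i, 0 ≤ lam i) ∧ ∃ i0, (∀ i, lam i ≤ lam i0) ∧ sigmaMax F ^ 2 = lam i0 := by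
  have key : ∀ i, ∃ w : Fin ℓ → ℝ, (∑ i, (w i)^2) = 1 ∧ (∑ j, (F.mulVec w j)^2) = lam i := by
    intro i
    have e : V.mulVec (Vᵀ.mulVec (Pi.single i 1)) = Pi.single i 1 := by
      rw [Matrix.mulVec_mulVec, hV, Matrix.one_mulVec]
    refine ⟨Vᵀ.mulVec (Pi.single i 1), ?_, ?_⟩
    · rw [← sumsq_V V hV', e]
      simp [Pi.single_apply]
    · rw [sumsq_F F V lam hF, e]
      simp [Pi.single_apply]
  have h0 : ∀ i, 0 ≤ lam i := fun i => by
    obtain ⟨w, _, h⟩ := key i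
    rw [← h]; positivity
  refine ⟨h0, ?_⟩
  have : Nonempty (Fin ℓ) := ⟨⟨0, hℓ⟩⟩
  obtain ⟨i0, hi0⟩ := Finite.exists_max lam
  refine ⟨i0, hi0, ?_⟩
  have : IsGreatest {x : ℝ | ∃ w : Fin ℓ → ℝ, (∑ i, (w i)^2) = 1 ∧
      x = Real.sqrt (∑ j, (F.mulVec w j)^2)} (√ (lam i0)) := by
    constructor
    · obtain ⟨w, h1, h2⟩ := key i0
      exact ⟨w, h1, by rw [h2]⟩
    · rintro x ⟨w, h1, rfl⟩
      apply Real.sqrt_le_sqrt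
      rw [sumsq_F F V lam hF]
      calc _ ≤ ∑ i, lam i0 * (V.mulVec w i)^2 :=
            Finset.sum_le_sum fun i _ => mul_le_mul_of_nonneg_right (hi0 i) (sq_nonneg _)
        _ = lam i0 := by rw [← Finset.mul_sum, sumsq_V V hV', h1, mul_one]
  rw [sigmaMax, this.csSup_eq, Real.sq_sqrt (h0 _)]

theorem Sq_eq {s ℓ : ℕ} (F : Matrix (Fin s) (Fin ℓ) ℝ) (V : Matrix (Fin ℓ) (Fin ℓ) ℝ)
    (lam : Fin ℓ → ℝ) (hV : V * Vᵀ = 1) (hV' : Vᵀ * V = 1)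
    (hF : Fᵀ * F = Vᵀ * diagonal lam * V) (q : ℝ) (hq : ∀ i, 1 - q * lam i ≠ 0) :
    Sq F q = Vᵀ * diagonal (fun i => (1 - q * lam i)⁻¹) * V := by
  rw [Sq]
  apply Matrix.inv_eq_right_inv
  have e : 1 - q • (Fᵀ * F) = Vᵀ * diagonal (fun i => 1 - q * lam i) * V := by
    have : diagonal (fun i => 1 - q * lam i) = 1 - q • diagonal lam := by
      ext i j
      by_cases h : i = j <;> simp [h]
    rw [this, hF, mul_sub, sub_mul, mul_one, hV']
    simp
  rw [e]
  calc _ = Vᵀ * diagonal (fun i => 1 - q * lam i) * (V * Vᵀ) *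
        diagonal (fun i => (1 - q * lam i)⁻¹) * V := by simp only [mul_assoc]
    _ = Vᵀ * (diagonal (fun i => 1 - q * lam i) *
        diagonal (fun i => (1 - q * lam i)⁻¹)) * V := by rw [hV]; simp only [mul_assoc, one_mul]
    _ = 1 := by
      rw [diagonal_mul_diagonal]
      simp [hq, hV']

theorem trace_conj {ℓ : ℕ} (V D : Matrix (Fin ℓ) (Fin ℓ) ℝ) (hV : V * Vᵀ = 1) :
    (Vᵀ * D * V).trace = D.trace := by
  rw [mul_assoc, Matrix.trace_mul_comm, mul_assoc, hV, mul_one]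

theorem det_conj {ℓ : ℕ} (V D : Matrix (Fin ℓ) (Fin ℓ) ℝ) (hV' : Vᵀ * V = 1) :
    (Vᵀ * D * V).det = D.det := by
  rw [Matrix.det_mul, Matrix.det_mul, mul_right_comm, ← Matrix.det_mul, hV']; simp

/-- scalar version of anisotropy -/
noncomputable def sA {ℓ : ℕ} (lam : Fin ℓ → ℝ) (q : ℝ) : ℝ :=
  (ℓ / 2 : ℝ) * Real.log ((∑ i, (1 - q * lam i)⁻¹) / ℓ) + (1 / 2) * ∑ i, Real.log (1 - q * lam i)

/-- scalar version of squared norm -/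
noncomputable def sN {ℓ : ℕ} (lam : Fin ℓ → ℝ) (q : ℝ) : ℝ :=
  (∑ i, lam i * (1 - q * lam i)⁻¹) / ∑ i, (1 - q * lam i)⁻¹

theorem Afun_eq {s ℓ : ℕ} (F : Matrix (Fin s) (Fin ℓ) ℝ) (V : Matrix (Fin ℓ) (Fin ℓ) ℝ)
    (lam : Fin ℓ → ℝ) (hV : V * Vᵀ = 1) (hV' : Vᵀ * V = 1)
    (hF : Fᵀ * F = Vᵀ * diagonal lam * V) (q : ℝ) (hℓ : 0 < ℓ) (hq : ∀ i, 0 < 1 - q * lam i) :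
    Afun F q = sA lam q := by
  have : Nonempty (Fin ℓ) := ⟨⟨0, hℓ⟩⟩
  have hT : 0 < ∑ i, (1 - q * lam i)⁻¹ :=
    Finset.sum_pos (fun i _ => inv_pos.2 (hq i)) Finset.univ_nonempty
  have hl : (0:ℝ) < ℓ := by exact_mod_cast hℓ
  rw [Afun, Sq_eq F V lam hV hV' hF q (fun i => (hq i).ne'), Matrix.det_smul, det_conj _ _ hV',
    trace_conj _ _ hV, det_diagonal, trace_diagonal, sA, Real.log_mul, Real.log_pow, Real.log_prod,
    Real.log_div hT.ne' hl.ne', Real.log_div hl.ne' hT.ne']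
  · simp only [Real.log_inv, Fintype.card_fin, Finset.sum_neg_distrib]
    ring
  · exact fun i _ => inv_ne_zero (hq i).ne'
  · exact pow_ne_zero _ (div_pos hl hT).ne'
  · exact Finset.prod_ne_zero_iff.2 fun i _ => inv_ne_zero (hq i).ne'

theorem Nfun_eq {s ℓ : ℕ} (F : Matrix (Fin s) (Fin ℓ) ℝ) (V : Matrix (Fin ℓ) (Fin ℓ) ℝ)
    (lam : Fin ℓ → ℝ) (hV : V * Vᵀ = 1) (hV' : Vᵀ * V = 1)
    (hF : Fᵀ * F = Vᵀ * diagonal lam * V) (q : ℝ) (hq : ∀ i, 0 < 1 - q * lam i) :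
    Nfun F q = √ (sN lam q) := by
  have e : Fᵀ * F * Sq F q = Vᵀ * diagonal (fun i => lam i * (1 - q * lam i)⁻¹) * V := by
    rw [Sq_eq F V lam hV hV' hF q (fun i => (hq i).ne'), hF, ← diagonal_mul_diagonal]
    calc _ = Vᵀ * diagonal lam * (V * Vᵀ) * diagonal (fun i => (1 - q * lam i)⁻¹) * V := by
          simp only [mul_assoc]
      _ = _ := by rw [hV]; simp only [mul_assoc, one_mul]
  rw [Nfun, e, Sq_eq F V lam hV hV' hF q (fun i => (hq i).ne'), trace_conj _ _ hV,
    trace_conj _ _ hV, trace_diagonal, trace_diagonal, sN]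

theorem sA_hasDeriv {ℓ : ℕ} (lam : Fin ℓ → ℝ) (q : ℝ) (hℓ : 0 < ℓ)
    (hq : ∀ i, 0 < 1 - q * lam i) :
    HasDerivAt (sA lam) ((ℓ / 2 : ℝ) * (((∑ i, lam i * ((1 - q * lam i)⁻¹)^2) / ℓ) /
      ((∑ i, (1 - q * lam i)⁻¹) / ℓ)) + (1 / 2) * ∑ i, (-lam i * (1 - q * lam i)⁻¹)) q := by
  have : Nonempty (Fin ℓ) := ⟨⟨0, hℓ⟩⟩
  have hT : 0 < ∑ i, (1 - q * lam i)⁻¹ :=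
    Finset.sum_pos (fun i _ => inv_pos.2 (hq i)) Finset.univ_nonempty
  have hl : (0:ℝ) < ℓ := by exact_mod_cast hℓ
  have h1 : ∀ i, HasDerivAt (fun q => 1 - q * lam i) (-lam i) q := fun i => by
    simpa using ((hasDerivAt_id q).mul_const (lam i)).const_sub 1
  have h2 : ∀ i, HasDerivAt (fun q => (1 - q * lam i)⁻¹) (lam i * ((1 - q * lam i)⁻¹)^2) q :=
    fun i => by
      have := (h1 i).fun_inv (hq i).ne'
      rwa [neg_neg, div_eq_mul_inv, ← inv_pow] at this
  have h3 : HasDerivAt (fun q => ∑ i, (1 - q * lam i)⁻¹)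
      (∑ i, lam i * ((1 - q * lam i)⁻¹)^2) q := HasDerivAt.fun_sum fun i _ => h2 i
  have h4 : HasDerivAt (fun q => ∑ i, Real.log (1 - q * lam i))
      (∑ i, (-lam i * (1 - q * lam i)⁻¹)) q := HasDerivAt.fun_sum fun i _ => by
    simpa [div_eq_mul_inv] using (h1 i).log (hq i).ne'
  exact (((h3.div_const (ℓ:ℝ)).log (div_pos hT hl).ne').const_mul (ℓ / 2 : ℝ)).add
    (h4.const_mul (1/2))

theorem sA_deriv_pos {ℓ : ℕ} (lam : Fin ℓ → ℝ) (q : ℝ) (hℓ : 0 < ℓ) (hq0 : 0 < q)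
    (hq : ∀ i, 0 < 1 - q * lam i) (i0 j0 : Fin ℓ) (hne : lam j0 < lam i0) :
    0 < deriv (sA lam) q := by
  have : Nonempty (Fin ℓ) := ⟨⟨0, hℓ⟩⟩
  rw [(sA_hasDeriv lam q hℓ hq).deriv]
  set x : Fin ℓ → ℝ := fun i => (1 - q * lam i)⁻¹ with hx
  have hxp : ∀ i, 0 < x i := fun i => inv_pos.2 (hq i)
  have hxe : ∀ i, x i * (1 - q * lam i) = 1 := fun i => inv_mul_cancel₀ (hq i).ne'
  change 0 < (ℓ / 2 : ℝ) * (((∑ i, lam i * (x i)^2) / ℓ) /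
      ((∑ i, x i) / ℓ)) + (1 / 2) * ∑ i, (-lam i * x i)
  have hT : 0 < ∑ i, x i := Finset.sum_pos (fun i _ => hxp i) Finset.univ_nonempty
  have hl : (0:ℝ) < ℓ := by exact_mod_cast hℓ
  have e1 : ∑ i, ∑ j, (x i - x j) * (lam i * x i - lam j * x j) =
      2 * (ℓ * (∑ i, lam i * (x i)^2) - (∑ i, x i) * ∑ i, lam i * x i) := by
    have : ∀ i j, (x i - x j) * (lam i * x i - lam j * x j) =
      lam i * x i ^ 2 - x i * (lam j * x j) - (lam i * x i) * x j + lam j * x j ^ 2 := by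
      intros; ring
    simp only [this, Finset.sum_add_distrib, Finset.sum_sub_distrib, ← Finset.mul_sum,
      ← Finset.sum_mul, Finset.sum_const, Finset.card_univ, Fintype.card_fin, nsmul_eq_mul]
    have e : ∑ i, lam i * ((ℓ:ℝ) * x i ^ 2) = ℓ * ∑ i, lam i * x i ^ 2 := by
      rw [Finset.mul_sum]
      exact Finset.sum_congr rfl fun i _ => by ring
    rw [e]
    ring
  have e2 : ∀ i j, (x i - x j) * (lam i * x i - lam j * x j) =
      q * ((lam i - lam j) * x i * x j)^2 := by
    intro i j
    have a1 : x i - x j = q * ((lam i - lam j) * x i * x j) := by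
      linear_combination x i * hxe j * (-1) + x j * hxe i
    have a2 : lam i * x i - lam j * x j = (lam i - lam j) * x i * x j := by
      linear_combination (-lam i * x i) * hxe j + lam j * x j * hxe i
    rw [a1, a2]; ring
  have pos : 0 < ∑ i, ∑ j, (x i - x j) * (lam i * x i - lam j * x j) := by
    simp only [e2]
    refine Finset.sum_pos' (fun i _ => Finset.sum_nonneg fun j _ => by positivity)
      ⟨i0, Finset.mem_univ _, ?_⟩
    refine Finset.sum_pos' (fun j _ => by positivity) ⟨j0, Finset.mem_univ _, ?_⟩
    have := mul_pos (mul_pos (sub_pos.2 hne) (hxp i0)) (hxp j0)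
    positivity
  rw [e1] at pos
  have e3 : (ℓ / 2 : ℝ) * (((∑ i, lam i * (x i)^2) / ℓ) /
      ((∑ i, x i) / ℓ)) + (1 / 2) * ∑ i, (-lam i * x i) =
      (ℓ * (∑ i, lam i * (x i)^2) - (∑ i, x i) * ∑ i, lam i * x i) / (2 * ∑ i, x i) := by
    have : ∑ i, (-lam i * x i) = - ∑ i, lam i * x i := by simp
    rw [this]
    field_simp
    ring
  rw [e3]
  apply div_pos <;> linarith

theorem lam_pos_aux {ℓ : ℕ} (lam : Fin ℓ → ℝ) (i0 : Fin ℓ) (hp : 0 < lam i0)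
    (hmax : ∀ i, lam i ≤ lam i0) (q : ℝ) (hq : q ∈ Set.Ico 0 (lam i0)⁻¹) (i : Fin ℓ) :
    0 < 1 - q * lam i := by
  have h1 : q * lam i0 < 1 := by
    have := mul_lt_mul_of_pos_right hq.2 hp
    rwa [inv_mul_cancel₀ hp.ne'] at this
  have h2 := mul_le_mul_of_nonneg_left (hmax i) hq.1
  linarith

theorem sA_cont {ℓ : ℕ} (lam : Fin ℓ → ℝ) (i0 : Fin ℓ) (hp : 0 < lam i0)
    (hmax : ∀ i, lam i ≤ lam i0) : ContinuousOn (sA lam) (Set.Ico 0 (lam i0)⁻¹) :=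
  fun q hq => (sA_hasDeriv lam q i0.pos
    (lam_pos_aux lam i0 hp hmax q hq)).continuousAt.continuousWithinAt

theorem sA_strictMono {ℓ : ℕ} (lam : Fin ℓ → ℝ) (i0 j0 : Fin ℓ) (hp : 0 < lam i0)
    (hmax : ∀ i, lam i ≤ lam i0) (hne : lam j0 < lam i0) :
    StrictMonoOn (sA lam) (Set.Ico 0 (lam i0)⁻¹) := by
  refine strictMonoOn_of_deriv_pos (convex_Ico _ _) (sA_cont lam i0 hp hmax) ?_
  intro q hq
  rw [interior_Ico] at hq
  exact sA_deriv_pos lam q i0.pos hq.1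
    (lam_pos_aux lam i0 hp hmax q ⟨hq.1.le, hq.2⟩) i0 j0 hne

theorem sA_zero {ℓ : ℕ} (lam : Fin ℓ → ℝ) (hℓ : 0 < ℓ) : sA lam 0 = 0 := by
  have hl : (ℓ:ℝ) ≠ 0 := by exact_mod_cast hℓ.ne'
  simp [sA, hl]

theorem sA_large {ℓ : ℕ} (lam : Fin ℓ → ℝ) (i0 j0 : Fin ℓ) (hp : 0 < lam i0)
    (h0 : ∀ i, 0 ≤ lam i)
    (hmax : ∀ i, lam i ≤ lam i0) (hne : lam j0 < lam i0) (a : ℝ) :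
    ∃ q ∈ Set.Ico 0 (lam i0)⁻¹, a ≤ sA lam q := by
  have hl : (0:ℝ) < ℓ := by exact_mod_cast i0.pos
  set δ : ℝ := 1 - lam j0 / lam i0 with hδ
  have hδp : 0 < δ := by rw [hδ, sub_pos, div_lt_one hp]; exact hne
  -- choose t = log of the largest `x`
  set t : ℝ := max 0 (2 * a + ℓ * Real.log ℓ - Real.log δ) with ht
  have ht0 : 0 ≤ t := le_max_left _ _
  have ht1 : 2 * a + ℓ * Real.log ℓ - Real.log δ ≤ t := le_max_right _ _
  have he1 : Real.exp (-t) ≤ 1 := Real.exp_le_one_iff.2 (by linarith)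
  set q : ℝ := (1 - Real.exp (-t)) * (lam i0)⁻¹ with hq
  have hqm : q ∈ Set.Ico 0 (lam i0)⁻¹ := by
    have := Real.exp_pos (-t)
    have hi := inv_pos.2 hp
    constructor
    · exact mul_nonneg (by linarith) hi.le
    · rw [hq]; nlinarith
  have hpos := lam_pos_aux lam i0 hp hmax q hqm
  refine ⟨q, hqm, ?_⟩
  have e0 : 1 - q * lam i0 = Real.exp (-t) := by
    rw [hq, mul_assoc, inv_mul_cancel₀ hp.ne']; ring
  have hlog : ∀ i, -t ≤ Real.log (1 - q * lam i) := fun i => by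
    rw [Real.le_log_iff_exp_le (hpos i), ← e0]
    have := mul_le_mul_of_nonneg_left (hmax i) hqm.1
    linarith
  have hj : Real.log δ ≤ Real.log (1 - q * lam j0) := by
    apply Real.log_le_log hδp
    have := mul_le_mul_of_nonneg_right hqm.2.le (h0 j0)
    rw [hδ, div_eq_inv_mul]; linarith
  have hsum : Real.log δ - (ℓ - 1) * t ≤ ∑ i, Real.log (1 - q * lam i) := by
    rw [← Finset.add_sum_erase _ _ (Finset.mem_univ j0)]
    have : ∑ i ∈ Finset.univ.erase j0, (-t) ≤ ∑ i ∈ Finset.univ.erase j0, Real.log (1 - q * lam i) :=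
      Finset.sum_le_sum fun i _ => hlog i
    rw [Finset.sum_const, Finset.card_erase_of_mem (Finset.mem_univ _), Finset.card_univ,
      Fintype.card_fin, nsmul_eq_mul, Nat.cast_sub i0.pos, Nat.cast_one] at this
    linarith
  have hT : Real.exp t ≤ ∑ i, (1 - q * lam i)⁻¹ := by
    have : (1 - q * lam i0)⁻¹ ≤ ∑ i, (1 - q * lam i)⁻¹ :=
      Finset.single_le_sum (f := fun i => (1 - q * lam i)⁻¹)
        (fun i _ => (inv_pos.2 (hpos i)).le) (Finset.mem_univ i0)
    rwa [e0, Real.exp_neg, inv_inv] at this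
  have hTp : 0 < ∑ i, (1 - q * lam i)⁻¹ := (Real.exp_pos t).trans_le hT
  have hlT : t - Real.log ℓ ≤ Real.log ((∑ i, (1 - q * lam i)⁻¹) / ℓ) := by
    rw [Real.log_div hTp.ne' hl.ne']
    have := (Real.le_log_iff_exp_le hTp).2 hT
    linarith
  have := mul_le_mul_of_nonneg_left hlT (by positivity : (0:ℝ) ≤ ℓ / 2)
  rw [sA]
  nlinarith

theorem sN_nonneg {ℓ : ℕ} (lam : Fin ℓ → ℝ) (h0 : ∀ i, 0 ≤ lam i) (q : ℝ)
    (hq : ∀ i, 0 < 1 - q * lam i) : 0 ≤ sN lam q := by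
  apply div_nonneg <;> apply Finset.sum_nonneg <;> intro i _
  · exact mul_nonneg (h0 i) (inv_pos.2 (hq i)).le
  · exact (inv_pos.2 (hq i)).le

theorem one_sub_sN {ℓ : ℕ} (lam : Fin ℓ → ℝ) (hℓ : 0 < ℓ) (q : ℝ)
    (hq : ∀ i, 0 < 1 - q * lam i) :
    1 - q * sN lam q = ℓ / ∑ i, (1 - q * lam i)⁻¹ := by
  have : Nonempty (Fin ℓ) := ⟨⟨0, hℓ⟩⟩
  have hT : 0 < ∑ i, (1 - q * lam i)⁻¹ :=
    Finset.sum_pos (fun i _ => inv_pos.2 (hq i)) Finset.univ_nonempty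
  rw [sN, eq_div_iff hT.ne', sub_mul, mul_assoc, div_mul_cancel₀ _ hT.ne', one_mul, Finset.mul_sum,
    ← Finset.sum_sub_distrib]
  have : ∀ i, (1 - q * lam i)⁻¹ - q * (lam i * (1 - q * lam i)⁻¹) = 1 := fun i => by
    have := inv_mul_cancel₀ (hq i).ne'
    linear_combination this
  simp [this]

theorem sA_eq {ℓ : ℕ} (lam : Fin ℓ → ℝ) (hℓ : 0 < ℓ) (q : ℝ)
    (hq : ∀ i, 0 < 1 - q * lam i) :
    sA lam q = -(ℓ / 2 : ℝ) * Real.log (1 - q * sN lam q)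
      + (1 / 2) * ∑ i, Real.log (1 - q * lam i) := by
  rw [one_sub_sN lam hℓ q hq, sA, ← inv_div (∑ i, (1 - q * lam i)⁻¹) (ℓ:ℝ), Real.log_inv]
  ring

theorem sN_cont {ℓ : ℕ} (lam : Fin ℓ → ℝ) (hℓ : 0 < ℓ) (q : ℝ)
    (hq : ∀ i, 0 < 1 - q * lam i) : ContinuousAt (sN lam) q := by
  have : Nonempty (Fin ℓ) := ⟨⟨0, hℓ⟩⟩
  have hT : 0 < ∑ i, (1 - q * lam i)⁻¹ :=
    Finset.sum_pos (fun i _ => inv_pos.2 (hq i)) Finset.univ_nonempty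
  have h : ∀ i, ContinuousAt (fun q => (1 - q * lam i)⁻¹) q := fun i =>
    ContinuousAt.inv₀ (by fun_prop) (hq i).ne'
  have hs : ∀ g : Fin ℓ → ℝ → ℝ, (∀ i, ContinuousAt (g i) q) →
      ContinuousAt (fun q => ∑ i, g i q) q := fun g hg => tendsto_finsetSum _ fun i _ => hg i
  exact ContinuousAt.div (hs _ fun i => continuousAt_const.mul (h i)) (hs _ h) hT.ne'

/-- one-dimensional centred Gaussian density with variance `v` -/
noncomputable def g1 (v x : ℝ) : ℝ := ProbabilityTheory.gaussianPDFReal 0 v.toNNReal x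

theorem g1_pos {v : ℝ} (hv : 0 < v) (x : ℝ) : 0 < g1 v x :=
  ProbabilityTheory.gaussianPDFReal_pos _ _ _ (by simpa using hv)

theorem g1_int (v : ℝ) : Integrable (g1 v) :=
  ProbabilityTheory.integrable_gaussianPDFReal _ _

theorem g1_total {v : ℝ} (hv : 0 < v) : ∫ x, g1 v x = 1 :=
  ProbabilityTheory.integral_gaussianPDFReal_eq_one _ (by simpa using hv)

theorem g1_log {v : ℝ} (hv : 0 < v) (x : ℝ) :
    Real.log (g1 v x) = -(1/2) * Real.log (2 * π * v) - x^2 / (2 * v) := by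
  have : 0 < 2 * π * v := by positivity
  rw [g1, ProbabilityTheory.gaussianPDFReal, Real.coe_toNNReal _ hv.le, Real.log_mul,
    Real.log_inv, Real.log_sqrt this.le, Real.log_exp]
  · ring
  · positivity
  · positivity

theorem g1_mom_integrable {v : ℝ} (hv : 0 < v) : Integrable (fun x => x^2 * g1 v x) := by
  have hb : 0 < 1 / (2 * v) := by positivity
  have := (integrable_rpow_mul_exp_neg_mul_sq hb (s := 2) (by norm_num)).mul_const (√(2 * π * v))⁻¹
  refine this.congr (Filter.Eventually.of_forall fun x => ?_)
  simp only [g1, ProbabilityTheory.gaussianPDFReal, Real.coe_toNNReal _ hv.le]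
  have e : -(x - 0)^2 / (2 * v) = -(1 / (2 * v)) * x^2 := by ring
  rw [e]
  norm_cast
  ring

theorem g1_mom {v : ℝ} (hv : 0 < v) : ∫ x, x^2 * g1 v x = v := by
  have h0 : v.toNNReal ≠ 0 := by simpa using hv
  have h1 := ProbabilityTheory.variance_fun_id_gaussianReal (μ := 0) (v := v.toNNReal)
  rw [ProbabilityTheory.variance_eq_integral (by fun_prop)] at h1
  simp only [ProbabilityTheory.integral_id_gaussianReal, sub_zero] at h1
  rw [ProbabilityTheory.integral_gaussianReal_eq_integral_smul h0, Real.coe_toNNReal _ hv.le] at h1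
  refine Eq.trans ?_ h1
  simp [g1, mul_comm]

/-- product Gaussian density -/
noncomputable def gP {ℓ : ℕ} (v : Fin ℓ → ℝ) (y : Fin ℓ → ℝ) : ℝ := ∏ i, g1 (v i) (y i)

theorem gP_pos {ℓ : ℕ} {v : Fin ℓ → ℝ} (hv : ∀ i, 0 < v i) (y : Fin ℓ → ℝ) : 0 < gP v y :=
  Finset.prod_pos fun i _ => g1_pos (hv i) _

theorem gP_int {ℓ : ℕ} (v : Fin ℓ → ℝ) : Integrable (gP v) :=
  Integrable.fintype_prod fun i => g1_int (v i)

theorem gP_total {ℓ : ℕ} {v : Fin ℓ → ℝ} (hv : ∀ i, 0 < v i) : ∫ y, gP v y = 1 := by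
  have := integral_fintype_prod_volume_eq_prod (𝕜 := ℝ) (fun i => g1 (v i))
  simp only [gP]
  rw [this]
  simp [g1_total (hv _)]

theorem gP_mom_eq {ℓ : ℕ} (v : Fin ℓ → ℝ) (k : Fin ℓ) (y : Fin ℓ → ℝ) :
    (y k)^2 * gP v y = ∏ i, (if i = k then fun x => x^2 * g1 (v i) x else g1 (v i)) (y i) := by
  rw [gP, ← Finset.mul_prod_erase _ _ (Finset.mem_univ k),
    ← Finset.mul_prod_erase (Finset.univ) (fun i =>
      (if i = k then fun x => x^2 * g1 (v i) x else g1 (v i)) (y i)) (Finset.mem_univ k), ← mul_assoc]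
  simp only [if_true]
  congr 1
  apply Finset.prod_congr rfl
  intro i hi
  rw [if_neg (Finset.ne_of_mem_erase hi)]

theorem gP_mom_integrable {ℓ : ℕ} {v : Fin ℓ → ℝ} (hv : ∀ i, 0 < v i) (k : Fin ℓ) :
    Integrable (fun y => (y k)^2 * gP v y) := by
  simp only [gP_mom_eq]
  apply Integrable.fintype_prod
  intro i
  split_ifs
  · exact g1_mom_integrable (hv i)
  · exact g1_int _

theorem gP_mom {ℓ : ℕ} {v : Fin ℓ → ℝ} (hv : ∀ i, 0 < v i) (k : Fin ℓ) :
    ∫ y : Fin ℓ → ℝ, (y k)^2 * gP v y = v k := by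
  simp only [gP_mom_eq]
  rw [integral_fintype_prod_volume_eq_prod (𝕜 := ℝ)
    (fun i => if i = k then fun x => x^2 * g1 (v i) x else g1 (v i)),
    ← Finset.mul_prod_erase _ _ (Finset.mem_univ k)]
  rw [Finset.prod_eq_one]
  · simp [g1_mom (hv k)]
  · intro i hi
    rw [if_neg (Finset.ne_of_mem_erase hi), g1_total (hv i)]

theorem gP_log {ℓ : ℕ} {v : Fin ℓ → ℝ} (hv : ∀ i, 0 < v i) (y : Fin ℓ → ℝ) :
    Real.log (gP v y) = -(1/2) * ∑ i, Real.log (2 * π * v i) - ∑ i, (y i)^2 * (1 / (2 * v i)) := by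
  rw [gP, Real.log_prod (fun i _ => (g1_pos (hv i) _).ne')]
  simp only [g1_log (hv _), Finset.sum_sub_distrib, Finset.mul_sum]
  congr 1
  exact Finset.sum_congr rfl fun i _ => by ring

theorem mp_V {ℓ : ℕ} (V : Matrix (Fin ℓ) (Fin ℓ) ℝ) (hV : V * Vᵀ = 1) :
    MeasurePreserving (fun w : Fin ℓ → ℝ => V.mulVec w) := by
  have h1 : V.det * V.det = 1 := by
    have := congrArg Matrix.det hV
    simpa using this
  have h2 : |V.det⁻¹| = 1 := by
    rcases mul_self_eq_one_iff.1 h1 with h | h <;> simp [h]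
  have h3 : V.det ≠ 0 := by intro h; simp [h] at h1
  refine ⟨by fun_prop, ?_⟩
  have := Real.map_matrix_volume_pi_eq_smul_volume_pi h3
  rw [h2, ENNReal.ofReal_one, one_smul] at this
  exact this

theorem me_V {ℓ : ℕ} (V : Matrix (Fin ℓ) (Fin ℓ) ℝ) (hV : V * Vᵀ = 1) (hV' : Vᵀ * V = 1) :
    MeasurableEmbedding (fun w : Fin ℓ → ℝ => V.mulVec w) := by
  let e : (Fin ℓ → ℝ) ≃ᵐ (Fin ℓ → ℝ) :=
    { toFun := fun w => V.mulVec w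
      invFun := fun w => Vᵀ.mulVec w
      left_inv := fun w => by simp [Matrix.mulVec_mulVec, hV']
      right_inv := fun w => by simp [Matrix.mulVec_mulVec, hV]
      measurable_toFun := by simp only [Equiv.coe_fn_mk]; fun_prop
      measurable_invFun := by simp only [Equiv.coe_fn_symm_mk]; fun_prop }
  exact e.measurableEmbedding

theorem gibbs {ℓ : ℕ} (f g : (Fin ℓ → ℝ) → ℝ) (hf : ∀ w, 0 ≤ f w) (hg : ∀ w, 0 < g w)
    (fi : Integrable f) (gi : Integrable g) (f1 : ∫ w, f w = 1) (gg1 : ∫ w, g w = 1)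
    (h1 : Integrable (fun w => f w * Real.log (f w)))
    (h2 : Integrable (fun w => f w * Real.log (g w))) :
    ∫ w, f w * Real.log (g w) ≤ ∫ w, f w * Real.log (f w) := by
  have : ∫ w, (f w * Real.log (g w) - f w * Real.log (f w)) ≤ ∫ w, (g w - f w) := by
    apply integral_mono (h2.sub h1) (gi.sub fi)
    intro w
    simp only [Pi.sub_apply]
    rcases (hf w).eq_or_lt with h | h
    · rw [← h]; simpa using (hg w).le
    · have := Real.log_le_sub_one_of_pos (div_pos (hg w) h)
      rw [Real.log_div (hg w).ne' h.ne'] at this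
      have := mul_le_mul_of_nonneg_left this h.le
      have e : f w * (g w / f w - 1) = g w - f w := by field_simp
      rw [e] at this
      linarith
  rw [integral_sub h2 h1, integral_sub gi fi, f1, gg1] at this
  linarith

theorem int_log_g {ℓ : ℕ} (V : Matrix (Fin ℓ) (Fin ℓ) ℝ) (f : (Fin ℓ → ℝ) → ℝ)
    {v : Fin ℓ → ℝ} (hv : ∀ i, 0 < v i)
    (fi : Integrable f) (f1 : ∫ w, f w = 1)
    (hm : ∀ i, Integrable (fun w : Fin ℓ → ℝ => (V.mulVec w i)^2 * f w)) :
    Integrable (fun w => f w * Real.log (gP v (V.mulVec w))) ∧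
    ∫ w, f w * Real.log (gP v (V.mulVec w)) = -(1/2) * ∑ i, Real.log (2 * π * v i)
      - ∑ i, (∫ w : Fin ℓ → ℝ, (V.mulVec w i)^2 * f w) * (1 / (2 * v i)) := by
  have e : (fun w => f w * Real.log (gP v (V.mulVec w))) =
      fun w => (-(1/2) * ∑ i, Real.log (2 * π * v i)) * f w
        - ∑ i, ((V.mulVec w i)^2 * f w) * (1 / (2 * v i)) := by
    ext w
    rw [gP_log hv, mul_sub, mul_comm]
    congr 1
    rw [Finset.mul_sum]
    exact Finset.sum_congr rfl fun i _ => by ring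
  have i1 : Integrable (fun w => (-(1/2) * ∑ i, Real.log (2 * π * v i)) * f w) := fi.const_mul _
  have i2 : ∀ i, Integrable (fun w : Fin ℓ → ℝ => ((V.mulVec w i)^2 * f w) * (1 / (2 * v i))) :=
    fun i => (hm i).mul_const _
  have i3 : Integrable (fun w : Fin ℓ → ℝ => ∑ i, ((V.mulVec w i)^2 * f w) * (1 / (2 * v i))) :=
    integrable_finsetSum _ fun i _ => i2 i
  rw [e]
  refine ⟨i1.sub i3, ?_⟩
  rw [integral_sub i1 i3, integral_finsetSum _ fun i _ => i2 i, integral_const_mul, f1, mul_one]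
  congr 1
  exact Finset.sum_congr rfl fun i _ => integral_mul_const _ _

theorem moments {s ℓ : ℕ} (F : Matrix (Fin s) (Fin ℓ) ℝ) (V : Matrix (Fin ℓ) (Fin ℓ) ℝ)
    (lam : Fin ℓ → ℝ) (hV' : Vᵀ * V = 1)
    (hF : Fᵀ * F = Vᵀ * diagonal lam * V) (f : (Fin ℓ → ℝ) → ℝ)
    (hm : ∀ i, Integrable (fun w : Fin ℓ → ℝ => (V.mulVec w i)^2 * f w)) :
    Ef ℓ f = ∑ i, (∫ w : Fin ℓ → ℝ, (V.mulVec w i)^2 * f w) ∧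
    (∫ w : Fin ℓ → ℝ, (∑ j, (F.mulVec w j)^2) * f w) =
      ∑ i, lam i * (∫ w : Fin ℓ → ℝ, (V.mulVec w i)^2 * f w) := by
  constructor
  · rw [Ef, ← integral_finsetSum _ fun i _ => hm i]
    congr 1
    ext w
    rw [← sumsq_V V hV', Finset.sum_mul]
  · have : ∀ i, lam i * (∫ w : Fin ℓ → ℝ, (V.mulVec w i)^2 * f w) =
        (∫ w : Fin ℓ → ℝ, lam i * ((V.mulVec w i)^2 * f w)) := fun i =>
      (integral_const_mul _ _).symm
    simp only [this]
    rw [← integral_finsetSum _ fun i _ => (hm i).const_mul _]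
    congr 1
    ext w
    rw [sumsq_F F V lam hF, Finset.sum_mul]
    exact Finset.sum_congr rfl fun i _ => by ring

theorem good_hm {ℓ : ℕ} (V : Matrix (Fin ℓ) (Fin ℓ) ℝ) (hV' : Vᵀ * V = 1)
    (f : (Fin ℓ → ℝ) → ℝ) (hf : IsGoodDensity ℓ f) (i : Fin ℓ) :
    Integrable (fun w : Fin ℓ → ℝ => (V.mulVec w i)^2 * f w) := by
  refine hf.moment_integrable.mono' ?_ (Filter.Eventually.of_forall fun w => ?_)
  · have : Measurable (fun w : Fin ℓ → ℝ => (V.mulVec w i)^2) := by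
      have : Measurable (fun w : Fin ℓ → ℝ => V.mulVec w) := by fun_prop
      fun_prop
    exact this.aestronglyMeasurable.mul hf.integrable.1
  · have h0 := hf.nonneg w
    rw [Real.norm_of_nonneg (by positivity), ← sumsq_V V hV']
    exact mul_le_mul_of_nonneg_right (Finset.single_le_sum (f := fun i => (V.mulVec w i)^2)
      (fun i _ => sq_nonneg _) (Finset.mem_univ i)) h0

theorem aniso_lower {s ℓ : ℕ} (F : Matrix (Fin s) (Fin ℓ) ℝ) (V : Matrix (Fin ℓ) (Fin ℓ) ℝ)
    (lam : Fin ℓ → ℝ) (hV : V * Vᵀ = 1) (hV' : Vᵀ * V = 1)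
    (hF : Fᵀ * F = Vᵀ * diagonal lam * V) (hℓ : 0 < ℓ) (q : ℝ)
    (hq : ∀ i, 0 < 1 - q * lam i)
    (f : (Fin ℓ → ℝ) → ℝ) (hf : IsGoodDensity ℓ f) (r : ℝ)
    (hr : r = (∫ w : Fin ℓ → ℝ, (∑ j, (F.mulVec w j)^2) * f w) / Ef ℓ f) :
    0 < 1 - q * r ∧ -(ℓ / 2 : ℝ) * Real.log (1 - q * r)
      + (1 / 2) * ∑ i, Real.log (1 - q * lam i) ≤ aniso ℓ f := by
  have hl : (0:ℝ) < ℓ := by exact_mod_cast hℓ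
  have hm := good_hm V hV' f hf
  obtain ⟨hE, hQ⟩ := moments F V lam hV' hF f hm
  have hEp := hf.moment_pos
  set E := Ef ℓ f with hEdef
  set m : Fin ℓ → ℝ := fun i => ∫ w : Fin ℓ → ℝ, (V.mulVec w i)^2 * f w with hmdef
  have hm0 : ∀ i, 0 ≤ m i := fun i => integral_nonneg fun w => mul_nonneg (sq_nonneg _) (hf.nonneg w)
  have hE' : E = ∑ i, m i := hE
  have hQ' : r = (∑ i, lam i * m i) / E := by rw [hr, hQ]
  have hsum : ∑ i, m i * (1 - q * lam i) = E * (1 - q * r) := by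
    have : ∑ i, m i * (1 - q * lam i) = ∑ i, m i - q * ∑ i, lam i * m i := by
      rw [Finset.mul_sum, ← Finset.sum_sub_distrib]
      exact Finset.sum_congr rfl fun i _ => by ring
    rw [this, ← hE', hQ']
    field_simp
  have hpos : 0 < ∑ i, m i * (1 - q * lam i) := by
    have : ∃ i ∈ Finset.univ, 0 < m i := by
      by_contra! hcon
      have : ∑ i, m i ≤ 0 := Finset.sum_nonpos hcon
      linarith
    obtain ⟨i, hi, him⟩ := this
    exact Finset.sum_pos' (fun i _ => mul_nonneg (hm0 i) (hq i).le) ⟨i, hi, mul_pos him (hq i)⟩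
  have h1r : 0 < 1 - q * r := by
    rw [hsum] at hpos
    exact (mul_pos_iff_of_pos_left hEp).1 hpos
  refine ⟨h1r, ?_⟩
  set c : ℝ := E * (1 - q * r) / ℓ with hc
  have hcp : 0 < c := by positivity
  set v : Fin ℓ → ℝ := fun i => c / (1 - q * lam i) with hv
  have hvp : ∀ i, 0 < v i := fun i => div_pos hcp (hq i)
  obtain ⟨j1, j2⟩ := int_log_g V f hvp hf.integrable hf.total hm
  have mp := mp_V V hV
  have me := me_V V hV hV'
  have gi : Integrable (fun w => gP v (V.mulVec w)) :=
    (mp.integrable_comp_emb me).2 (gP_int v)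
  have gt : ∫ w, gP v (V.mulVec w) = 1 := by
    rw [mp.integral_comp me (gP v), gP_total hvp]
  have gb := gibbs f (fun w => gP v (V.mulVec w)) hf.nonneg (fun w => gP_pos hvp _) hf.integrable gi
    hf.total gt hf.entropy_integrable j1
  rw [j2] at gb
  have s1 : ∑ i, Real.log (2 * π * v i) =
      ℓ * Real.log (2 * π * c) - ∑ i, Real.log (1 - q * lam i) := by
    have : ∀ i, Real.log (2 * π * v i) = Real.log (2 * π * c) - Real.log (1 - q * lam i) := fun i => by
      rw [hv, ← mul_div_assoc, Real.log_div (by positivity) (hq i).ne']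
    simp [this]
  have s2 : ∑ i, m i * (1 / (2 * v i)) = ℓ / 2 := by
    have : ∀ i, m i * (1 / (2 * v i)) = m i * (1 - q * lam i) * (1 / (2 * c)) := fun i => by
      have := (hq i).ne'
      simp only [hv]
      field_simp
    simp only [this]
    rw [← Finset.sum_mul, hsum, hc]
    field_simp
  change -(1/2) * ∑ i, Real.log (2 * π * v i) - ∑ i, m i * (1 / (2 * v i)) ≤ _ at gb
  rw [s1, s2] at gb
  have s3 : Real.log (2 * π * c) = Real.log (2 * π * E / ℓ) + Real.log (1 - q * r) := by
    rw [← Real.log_mul (by positivity) h1r.ne', hc]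
    congr 1
    ring
  have s4 : Real.log (2 * π * Real.exp 1 * E / ℓ) = Real.log (2 * π * E / ℓ) + 1 := by
    have : 2 * π * Real.exp 1 * E / ℓ = 2 * π * E / ℓ * Real.exp 1 := by ring
    rw [this, Real.log_mul (by positivity) (Real.exp_pos 1).ne', Real.log_exp]
  rw [s3] at gb
  rw [aniso, dEnt, ← hEdef, s4]
  linarith

theorem attain {s ℓ : ℕ} (F : Matrix (Fin s) (Fin ℓ) ℝ) (V : Matrix (Fin ℓ) (Fin ℓ) ℝ)
    (lam : Fin ℓ → ℝ) (hV : V * Vᵀ = 1) (hV' : Vᵀ * V = 1)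
    (hF : Fᵀ * F = Vᵀ * diagonal lam * V) (hℓ : 0 < ℓ) (q : ℝ)
    (hq : ∀ i, 0 < 1 - q * lam i) :
    ∃ f, IsGoodDensity ℓ f ∧ aniso ℓ f = sA lam q ∧ RMS F f = √ (sN lam q) := by
  have hl : (0:ℝ) < ℓ := by exact_mod_cast hℓ
  have : Nonempty (Fin ℓ) := ⟨⟨0, hℓ⟩⟩
  set v : Fin ℓ → ℝ := fun i => (1 - q * lam i)⁻¹ with hv
  have hvp : ∀ i, 0 < v i := fun i => inv_pos.2 (hq i)
  have hT : 0 < ∑ i, v i := Finset.sum_pos (fun i _ => hvp i) Finset.univ_nonempty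
  have mp := mp_V V hV
  have me := me_V V hV hV'
  have gi : Integrable (fun w => gP v (V.mulVec w)) :=
    (mp.integrable_comp_emb me).2 (gP_int v)
  have gt : ∫ w, gP v (V.mulVec w) = 1 := by
    rw [mp.integral_comp me (gP v), gP_total hvp]
  have hm : ∀ i, Integrable (fun w : Fin ℓ → ℝ => (V.mulVec w i)^2 * gP v (V.mulVec w)) := fun i =>
    (mp.integrable_comp_emb me).2 (gP_mom_integrable hvp i)
  have hmv : ∀ i, ∫ w : Fin ℓ → ℝ, (V.mulVec w i)^2 * gP v (V.mulVec w) = v i := fun i => by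
    rw [mp.integral_comp me (fun y => (y i)^2 * gP v y), gP_mom hvp]
  obtain ⟨j1, j2⟩ := int_log_g V (fun w => gP v (V.mulVec w)) hvp gi gt hm
  obtain ⟨hE, hQ⟩ := moments F V lam hV' hF _ hm
  simp only [hmv] at hE hQ j2
  refine ⟨fun w => gP v (V.mulVec w), ⟨fun w => (gP_pos hvp _).le, gi, gt, ?_, ?_, j1⟩, ?_, ?_⟩
  · have := integrable_finsetSum Finset.univ fun i _ => hm i
    refine this.congr (Filter.Eventually.of_forall fun w => ?_)
    simp only
    rw [← sumsq_V V hV' w, Finset.sum_mul]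
  · rw [hE]; exact hT
  · have s1 : ∑ i, Real.log (2 * π * v i) =
        ℓ * Real.log (2 * π) - ∑ i, Real.log (1 - q * lam i) := by
      have : ∀ i, Real.log (2 * π * v i) = Real.log (2 * π) - Real.log (1 - q * lam i) := fun i => by
        rw [Real.log_mul (by positivity) (hvp i).ne', hv, Real.log_inv]; ring
      simp [this]
    have s2 : ∑ i, v i * (1 / (2 * v i)) = ℓ / 2 := by
      have : ∀ i, v i * (1 / (2 * v i)) = 1 / 2 := fun i => by
        have := (hvp i).ne'
        field_simp
      simp only [this, Finset.sum_const, Finset.card_univ, Fintype.card_fin, nsmul_eq_mul]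
      ring
    have s4 : Real.log (2 * π * Real.exp 1 * (∑ i, v i) / ℓ) =
        Real.log (2 * π) + Real.log ((∑ i, v i) / ℓ) + 1 := by
      have : 2 * π * Real.exp 1 * (∑ i, v i) / ℓ = (2 * π) * ((∑ i, v i) / ℓ) * Real.exp 1 := by ring
      rw [this, Real.log_mul (by positivity) (Real.exp_pos 1).ne', Real.log_exp,
        Real.log_mul (by positivity) (by positivity)]
    rw [aniso, dEnt, j2, hE, s1, s2, s4, sA]
    ring
  · rw [RMS, hE, hQ, sN]

theorem rms_le {s ℓ : ℕ} (F : Matrix (Fin s) (Fin ℓ) ℝ) (V : Matrix (Fin ℓ) (Fin ℓ) ℝ)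
    (lam : Fin ℓ → ℝ) (hV : V * Vᵀ = 1) (hV' : Vᵀ * V = 1)
    (hF : Fᵀ * F = Vᵀ * diagonal lam * V) (hℓ : 0 < ℓ) (q : ℝ) (hq0 : 0 < q)
    (hq : ∀ i, 0 < 1 - q * lam i)
    (f : (Fin ℓ → ℝ) → ℝ) (hf : IsGoodDensity ℓ f) (hA : aniso ℓ f ≤ sA lam q) :
    RMS F f ≤ √ (sN lam q) := by
  have hl : (0:ℝ) < ℓ := by exact_mod_cast hℓ
  have : Nonempty (Fin ℓ) := ⟨⟨0, hℓ⟩⟩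
  obtain ⟨h1, h2⟩ := aniso_lower F V lam hV hV' hF hℓ q hq f hf _ rfl
  rw [RMS]
  apply Real.sqrt_le_sqrt
  set r := (∫ w : Fin ℓ → ℝ, (∑ j, (F.mulVec w j)^2) * f w) / Ef ℓ f
  have hT : 0 < ∑ i, (1 - q * lam i)⁻¹ :=
    Finset.sum_pos (fun i _ => inv_pos.2 (hq i)) Finset.univ_nonempty
  have h3 : 0 < 1 - q * sN lam q := by
    rw [one_sub_sN lam hℓ q hq]; positivity
  rw [sA_eq lam hℓ q hq] at hA
  have h4 : (ℓ / 2 : ℝ) * Real.log (1 - q * sN lam q) ≤ (ℓ / 2 : ℝ) * Real.log (1 - q * r) := by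
    linarith
  have h5 := le_of_mul_le_mul_left h4 (by positivity)
  have h6 := (Real.log_le_log_iff h3 h1).1 h5
  exact le_of_mul_le_mul_left (by linarith) hq0

/-- For every `a ≥ 0` there is a unique `q_a ∈ [0, σ_max(F)^{−2})` with
`𝒜(q_a) = a`, and the `a`-anisotropic norm is `⦀F⦀_a = 𝒩(q_a)`. -/
theorem anorm_eq_Nfun
    (s ℓ : ℕ) (F : Matrix (Fin s) (Fin ℓ) ℝ)
    (hΛ : ∀ c : ℝ, Fᵀ * F ≠ c • (1 : Matrix (Fin ℓ) (Fin ℓ) ℝ))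
    (a : ℝ) (ha : 0 ≤ a) :
    ∃ qa ∈ Set.Ico (0 : ℝ) ((sigmaMax F ^ 2)⁻¹),
      Afun F qa = a ∧
      (∀ q' ∈ Set.Ico (0 : ℝ) ((sigmaMax F ^ 2)⁻¹), Afun F q' = a → q' = qa) ∧
      anorm a F = Nfun F qa := by
  have hℓ : 0 < ℓ := by
    rcases Nat.eq_zero_or_pos ℓ with h | h
    · subst h
      exact absurd (Subsingleton.elim _ _) (hΛ 0)
    · exact h
  obtain ⟨V, lam, hV, hV', hF⟩ := diagz F
  obtain ⟨h0, i0, hmax, hσ⟩ := sigma_spec F V lam hV hV' hF hℓ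
  obtain ⟨j0, hne⟩ : ∃ j0, lam j0 < lam i0 := by
    by_contra! hcon
    apply hΛ (lam i0)
    have : lam = fun _ => lam i0 := funext fun i => le_antisymm (hmax i) (hcon i)
    have e : diagonal lam = lam i0 • (1 : Matrix (Fin ℓ) (Fin ℓ) ℝ) := by
      rw [Matrix.smul_one_eq_diagonal, ← this]
    rw [hF, e]
    simp [hV']
  have hp : 0 < lam i0 := (h0 j0).trans_lt hne
  rw [hσ]
  have hpos := lam_pos_aux lam i0 hp hmax
  have hmono := sA_strictMono lam i0 j0 hp hmax hne
  have hzero : (0:ℝ) ∈ Set.Ico 0 (lam i0)⁻¹ := ⟨le_rfl, inv_pos.2 hp⟩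
  obtain ⟨Q, hQ, hQa⟩ := sA_large lam i0 j0 hp h0 hmax hne a
  obtain ⟨qa, hqa, hqaa⟩ : ∃ qa ∈ Set.Ico 0 (lam i0)⁻¹, sA lam qa = a := by
    have hsub : Set.Icc 0 Q ⊆ Set.Ico 0 (lam i0)⁻¹ := fun x hx => ⟨hx.1, hx.2.trans_lt hQ.2⟩
    have := intermediate_value_Icc hQ.1 ((sA_cont lam i0 hp hmax).mono hsub)
    obtain ⟨x, hx, hxa⟩ := this (show a ∈ Set.Icc (sA lam 0) (sA lam Q) from
      ⟨by rw [sA_zero lam hℓ]; exact ha, hQa⟩)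
    exact ⟨x, hsub hx, hxa⟩
  have hAeq : ∀ q ∈ Set.Ico 0 (lam i0)⁻¹, Afun F q = sA lam q := fun q hq =>
    Afun_eq F V lam hV hV' hF q hℓ (hpos q hq)
  refine ⟨qa, hqa, (hAeq qa hqa).trans hqaa, ?_, ?_⟩
  · intro q' hq' h
    rw [hAeq q' hq'] at h
    exact hmono.injOn hq' hqa (h.trans hqaa.symm)
  · rw [Nfun_eq F V lam hV hV' hF qa (hpos qa hqa)]
    have hg : IsGreatest {x : ℝ | ∃ f : (Fin ℓ → ℝ) → ℝ,
        IsGoodDensity ℓ f ∧ aniso ℓ f ≤ a ∧ x = RMS F f} (√ (sN lam qa)) := by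
      constructor
      · obtain ⟨f, hf, hfa, hfr⟩ := attain F V lam hV hV' hF hℓ qa (hpos qa hqa)
        exact ⟨f, hf, (hfa.trans hqaa).le, hfr.symm⟩
      · rintro x ⟨f, hf, hfa, rfl⟩
        have hc : ContinuousAt (fun q => √ (sN lam q)) qa :=
          (sN_cont lam hℓ qa (hpos qa hqa)).sqrt
        have ht : Filter.Tendsto (fun q => √ (sN lam q)) (nhdsWithin qa (Set.Ioi qa))
            (nhds (√ (sN lam qa))) := hc.tendsto.mono_left nhdsWithin_le_nhds
        refine ge_of_tendsto ht ?_
        filter_upwards [Ioo_mem_nhdsGT hqa.2] with q hq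
        have hqm : q ∈ Set.Ico 0 (lam i0)⁻¹ := ⟨hqa.1.trans hq.1.le, hq.2⟩
        refine rms_le F V lam hV hV' hF hℓ q (hqa.1.trans_lt hq.1) (hpos q hqm) f hf ?_
        have := hmono hqa hqm hq.1
        linarith
    exact hg.csSup_eq
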